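/- arXiv:1410.4467 — 5 statements merged into one kernel-verified Lean document; each statement's English description precedes it below -/
import Mathlib

section
/- Let M̃_σ be the 9×9 integer matrix with rows (3,2,2,2,2,0,0,0,0), (−1,−1,0,−1,−1,0,0,0,0), (−1,−1,−1,0,−1,0,0,0,0), (−1,−1,−1,−1,0,0,0,0,0), (0,0,0,0,0,1,0,0,0), (0,0,0,0,0,0,1,0,0), (0,0,0,0,0,0,0,1,0), (0,0,0,0,0,0,0,0,1), (−1,0,−1,−1,−1,0,0,0,0), and let v₀ = (1,0,0,0,0,0,0,−1,−1) ∈ ℤ⁹. Then for every natural number n, the vector cₙ = M̃_σⁿ · v₀ satisfies 4(cₙ)₀ + 2Σᵢ₌₁⁸ (cₙ)ᵢ = 0. -/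
/-- The matrix `M̃_σ` of the composition of the standard Cremona transformation
centered at the first four of eight points with the cyclic permutation of the
point indices, acting on curve classes `N₁(X) ≅ ℤ⁹` (basis `h, e₁, …, e₈`). -/
def Msigma : Matrix (Fin 9) (Fin 9) ℤ :=
  !![3, 2, 2, 2, 2, 0, 0, 0, 0;
     -1, -1, 0, -1, -1, 0, 0, 0, 0;
     -1, -1, -1, 0, -1, 0, 0, 0, 0;
     -1, -1, -1, -1, 0, 0, 0, 0, 0;
     0, 0, 0, 0, 0, 1, 0, 0, 0;
     0, 0, 0, 0, 0, 0, 1, 0, 0;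
     0, 0, 0, 0, 0, 0, 0, 1, 0;
     0, 0, 0, 0, 0, 0, 0, 0, 1;
     -1, 0, -1, -1, -1, 0, 0, 0, 0]

/-- The class `h - e₇ - e₈` of the line through `p₇` and `p₈`. -/
def v0 : Fin 9 → ℤ := ![1, 0, 0, 0, 0, 0, 0, -1, -1]

/-- The anticanonical degree `4v₀ + 2(v₁ + ⋯ + v₈)` is invariant under `M̃_σ`. -/
theorem anticanonical_degree_Msigma_mulVec (v : Fin 9 → ℤ) :
    4 * Msigma.mulVec v 0 + 2 * ∑ i : Fin 8, Msigma.mulVec v i.succ =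
      4 * v 0 + 2 * ∑ i : Fin 8, v i.succ := by
  have h : Matrix.vecMul ![4, 2, 2, 2, 2, 2, 2, 2, 2] Msigma = ![4, 2, 2, 2, 2, 2, 2, 2, 2] := by
    decide
  have key := Matrix.dotProduct_mulVec ![4, 2, 2, 2, 2, 2, 2, 2, 2] Msigma v
  rw [h] at key
  simp only [dotProduct, Fin.sum_univ_succ (n := 8)] at key
  simpa [Fin.sum_univ_succ, mul_add] using key

/-- Every class `cₙ = M̃_σⁿ (h - e₇ - e₈)` is orthogonal to the anticanonical
divisor: `4(cₙ)₀ + 2Σᵢ₌₁⁸ (cₙ)ᵢ = 0`. -/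
theorem msigma_orbit_anticanonical_degree_zero (n : ℕ) :
    4 * (Msigma ^ n).mulVec v0 0 +
      2 * ∑ i : Fin 8, (Msigma ^ n).mulVec v0 i.succ = 0 := by
  induction n with
  | zero => decide
  | succ n ih =>
    rw [pow_succ', ← Matrix.mulVec_mulVec, anticanonical_degree_Msigma_mulVec, ih]
end

section
/- Let M̃_σ be the 9×9 integer matrix with rows (3,2,2,2,2,0,0,0,0), (−1,−1,0,−1,−1,0,0,0,0), (−1,−1,−1,0,−1,0,0,0,0), (−1,−1,−1,−1,0,0,0,0,0), (0,0,0,0,0,1,0,0,0), (0,0,0,0,0,0,1,0,0), (0,0,0,0,0,0,0,1,0), (0,0,0,0,0,0,0,0,1), (−1,0,−1,−1,−1,0,0,0,0), viewed as a linear map on ℚ⁹. There exists a vector w ∈ ℚ⁹ with (M̃_σ − I)² w ≠ 0 and (M̃_σ − I)³ w = 0; in particular the generalized eigenspace of M̃_σ for the eigenvalue 1 contains a Jordan block of size at least 3. -/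
/-- The matrix `M̃_σ` (Cremona transformation at the first four points followed
by the cyclic permutation of the eight point indices), viewed as a linear map
on `ℚ⁹`. -/
def MsigmaQ : Matrix (Fin 9) (Fin 9) ℚ :=
  !![3, 2, 2, 2, 2, 0, 0, 0, 0;
     -1, -1, 0, -1, -1, 0, 0, 0, 0;
     -1, -1, -1, 0, -1, 0, 0, 0, 0;
     -1, -1, -1, -1, 0, 0, 0, 0, 0;
     0, 0, 0, 0, 0, 1, 0, 0, 0;
     0, 0, 0, 0, 0, 0, 1, 0, 0;
     0, 0, 0, 0, 0, 0, 0, 1, 0;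
     0, 0, 0, 0, 0, 0, 0, 0, 1;
     -1, 0, -1, -1, -1, 0, 0, 0, 0]

theorem MsigmaQ_sub_one_mulVec_eq {x y : Fin 9 → ℚ}
    (h : MsigmaQ.mulVec x = x + y) : (MsigmaQ - 1).mulVec x = y := by
  rw [Matrix.sub_mulVec, h, Matrix.one_mulVec, add_sub_cancel_left]

/-- `M̃_σ` has a Jordan block of size at least 3 for the eigenvalue 1: there
is a vector `w` with `(M̃_σ - I)² w ≠ 0` and `(M̃_σ - I)³ w = 0`. -/
theorem msigma_jordan_block_size_three :
    ∃ w : Fin 9 → ℚ,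
      ((MsigmaQ - 1) ^ 2).mulVec w ≠ 0 ∧ ((MsigmaQ - 1) ^ 3).mulVec w = 0 := by
  have h₁ : (MsigmaQ - 1).mulVec ![-14, 3, 4, 4, 3, 1, 0, 0, 1] =
      ![0, 1, 0, -1, -2, -1, 0, 1, 2] := MsigmaQ_sub_one_mulVec_eq <| by
    ext i; fin_cases i <;> norm_num [MsigmaQ, Matrix.mulVec, dotProduct, Fin.sum_univ_succ]
  have h₂ : (MsigmaQ - 1).mulVec ![0, 1, 0, -1, -2, -1, 0, 1, 2] =
      ![-4, 1, 1, 1, 1, 1, 1, 1, 1] := MsigmaQ_sub_one_mulVec_eq <| by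
    ext i; fin_cases i <;> norm_num [MsigmaQ, Matrix.mulVec, dotProduct, Fin.sum_univ_succ]
  have h₃ : (MsigmaQ - 1).mulVec ![-4, 1, 1, 1, 1, 1, 1, 1, 1] = 0 :=
    MsigmaQ_sub_one_mulVec_eq <| by
      ext i; fin_cases i <;> norm_num [MsigmaQ, Matrix.mulVec, dotProduct, Fin.sum_univ_succ]
  refine ⟨![-14, 3, 4, 4, 3, 1, 0, 0, 1], ?_, ?_⟩
  · rw [pow_two, ← Matrix.mulVec_mulVec, h₁, h₂]
    intro h
    simpa using congrFun h 0
  · rw [pow_succ, pow_two, ← Matrix.mulVec_mulVec, ← Matrix.mulVec_mulVec, h₁, h₂, h₃]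
end

section
/- Let M̃_σ be the 9×9 integer matrix with rows (3,2,2,2,2,0,0,0,0), (−1,−1,0,−1,−1,0,0,0,0), (−1,−1,−1,0,−1,0,0,0,0), (−1,−1,−1,−1,0,0,0,0,0), (0,0,0,0,0,1,0,0,0), (0,0,0,0,0,0,1,0,0), (0,0,0,0,0,0,0,1,0), (0,0,0,0,0,0,0,0,1), (−1,0,−1,−1,−1,0,0,0,0), and let v₀ = (1,0,0,0,0,0,0,−1,−1) ∈ ℤ⁹. Then the sequence of first coordinates n ↦ (M̃_σⁿ · v₀)₀ is unbounded; consequently the set {M̃_σⁿ · v₀ : n ∈ ℕ} ⊆ ℤ⁹ is infinite. -/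
/-- The class `4h - e₁ - ⋯ - e₈`, fixed by `M̃_σ`. -/
def fixedClass : Fin 9 → ℤ := ![4, -1, -1, -1, -1, -1, -1, -1, -1]

theorem Msigma_mulVec_fixedClass : Msigma.mulVec fixedClass = fixedClass := by
  decide +kernel

theorem Msigma_pow_mulVec_fixedClass (n : ℕ) : (Msigma ^ n).mulVec fixedClass = fixedClass := by
  induction n with
  | zero => simp
  | succ n ih => rw [pow_succ, ← Matrix.mulVec_mulVec, Msigma_mulVec_fixedClass, ih]

theorem Msigma_pow_four_mulVec_v0 : (Msigma ^ 4).mulVec v0 = v0 + fixedClass := by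
  simp only [pow_succ, pow_zero, one_mul, ← Matrix.mulVec_mulVec]
  decide +kernel

theorem Msigma_pow_four_mul_mulVec_v0 (k : ℕ) :
    (Msigma ^ (4 * k)).mulVec v0 = v0 + k • fixedClass := by
  induction k with
  | zero => simp
  | succ k ih =>
    rw [mul_add_one, pow_add, ← Matrix.mulVec_mulVec, Msigma_pow_four_mulVec_v0,
      Matrix.mulVec_add, ih, Msigma_pow_mulVec_fixedClass, succ_nsmul, add_assoc]

theorem Msigma_pow_four_mul_mulVec_v0_zero (k : ℕ) :
    (Msigma ^ (4 * k)).mulVec v0 0 = 1 + 4 * k := by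
  rw [Msigma_pow_four_mul_mulVec_v0]
  simp [v0, fixedClass, mul_comm]

/-- The degrees (first coordinates) of the classes `M̃_σⁿ (h - e₇ - e₈)` grow
without bound; consequently the orbit `{M̃_σⁿ v₀ : n ∈ ℕ}` is infinite. -/
theorem msigma_orbit_degrees_unbounded :
    (∀ C : ℤ, ∃ n : ℕ, C < (Msigma ^ n).mulVec v0 0) ∧
      (Set.range fun n : ℕ => (Msigma ^ n).mulVec v0).Infinite := by
  refine ⟨fun C => ⟨4 * C.toNat, ?_⟩, ?_⟩
  · rw [Msigma_pow_four_mul_mulVec_v0_zero]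
    have := Int.self_le_toNat C
    omega
  · have inj : Function.Injective fun k : ℕ => (Msigma ^ (4 * k)).mulVec v0 := by
      intro a b hab
      have h := congrFun hab 0
      simp only [Msigma_pow_four_mul_mulVec_v0_zero] at h
      omega
    refine (Set.infinite_range_of_injective inj).mono ?_
    rintro _ ⟨k, rfl⟩
    exact ⟨4 * k, rfl⟩
end

section
/- Let M̃_σ be the 9×9 integer matrix with rows (3,2,2,2,2,0,0,0,0), (−1,−1,0,−1,−1,0,0,0,0), (−1,−1,−1,0,−1,0,0,0,0), (−1,−1,−1,−1,0,0,0,0,0), (0,0,0,0,0,1,0,0,0), (0,0,0,0,0,0,1,0,0), (0,0,0,0,0,0,0,1,0), (0,0,0,0,0,0,0,0,1), (−1,0,−1,−1,−1,0,0,0,0), and let v₀ = (1,0,0,0,0,0,0,−1,−1) ∈ ℤ⁹. Then the set S = {M̃_σⁿ · v₀ : n ∈ ℕ} is an infinite (hence countably infinite) set of vectors, each of which lies in the hyperplane {v ∈ ℤ⁹ : 2v₀ + v₁ + v₂ + ⋯ + v₈ = 0}. -/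
open Matrix

/-- Half the anticanonical divisor, as a functional on curve classes. -/
def halfAnticanonical : Fin 9 → ℤ := ![2, 1, 1, 1, 1, 1, 1, 1, 1]

/-- A generalized left eigenvector of rank two for the eigenvalue `1` of `Msigma`. -/
def rankTwoFunctional : Fin 9 → ℤ := ![4, 1, 2, 3, 4, 3, 2, 1, 0]

/-- A generalized left eigenvector of rank three for the eigenvalue `1` of `Msigma`. -/
def rankThreeFunctional : Fin 9 → ℤ := ![9, 3, 5, 6, 6, 3, 1, 0, 0]

lemma halfAnticanonical_vecMul : halfAnticanonical ᵥ* Msigma = halfAnticanonical := by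
  decide

lemma rankTwoFunctional_vecMul :
    rankTwoFunctional ᵥ* Msigma = rankTwoFunctional + halfAnticanonical := by
  decide

lemma rankThreeFunctional_vecMul :
    rankThreeFunctional ᵥ* Msigma = rankThreeFunctional + rankTwoFunctional := by
  decide

lemma dotProduct_pow_succ_mulVec (l : Fin 9 → ℤ) (n : ℕ) :
    l ⬝ᵥ (Msigma ^ (n + 1)) *ᵥ v0 = (l ᵥ* Msigma) ⬝ᵥ (Msigma ^ n) *ᵥ v0 := by
  rw [pow_succ', ← mulVec_mulVec, dotProduct_mulVec]

lemma halfAnticanonical_dotProduct_orbit (n : ℕ) :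
    halfAnticanonical ⬝ᵥ (Msigma ^ n) *ᵥ v0 = 0 := by
  induction n with
  | zero => rw [pow_zero, one_mulVec]; decide
  | succ n ih => rw [dotProduct_pow_succ_mulVec, halfAnticanonical_vecMul, ih]

lemma rankTwoFunctional_dotProduct_orbit (n : ℕ) :
    rankTwoFunctional ⬝ᵥ (Msigma ^ n) *ᵥ v0 = 3 := by
  induction n with
  | zero => rw [pow_zero, one_mulVec]; decide
  | succ n ih =>
    rw [dotProduct_pow_succ_mulVec, rankTwoFunctional_vecMul, add_dotProduct, ih,
      halfAnticanonical_dotProduct_orbit, add_zero]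

lemma rankThreeFunctional_dotProduct_orbit (n : ℕ) :
    rankThreeFunctional ⬝ᵥ (Msigma ^ n) *ᵥ v0 = 9 + 3 * n := by
  induction n with
  | zero => rw [pow_zero, one_mulVec]; decide
  | succ n ih =>
    rw [dotProduct_pow_succ_mulVec, rankThreeFunctional_vecMul, add_dotProduct, ih,
      rankTwoFunctional_dotProduct_orbit]
    push_cast
    ring

/-- The orbit `S = {M̃_σⁿ v₀ : n ∈ ℕ}` is an infinite (hence countably
infinite) set of curve classes, each lying in the hyperplane
`2v₀ + v₁ + ⋯ + v₈ = 0` of classes orthogonal to the anticanonical divisor. -/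
theorem msigma_orbit_infinite_in_anticanonical_hyperplane :
    (Set.range fun n : ℕ => (Msigma ^ n).mulVec v0).Infinite ∧
      ∀ v ∈ (Set.range fun n : ℕ => (Msigma ^ n).mulVec v0),
        2 * v 0 + ∑ i : Fin 8, v i.succ = 0 := by
  constructor
  · refine Set.infinite_range_of_injective fun m n hmn => ?_
    have h := congrArg (rankThreeFunctional ⬝ᵥ ·) hmn
    simp only [rankThreeFunctional_dotProduct_orbit] at h
    omega
  · rintro _ ⟨n, rfl⟩
    have h := halfAnticanonical_dotProduct_orbit n
    simpa [dotProduct, halfAnticanonical, Fin.sum_univ_succ] using h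
end

section
/- Let M̃_σ be the 9×9 integer matrix with rows (3,2,2,2,2,0,0,0,0), (−1,−1,0,−1,−1,0,0,0,0), (−1,−1,−1,0,−1,0,0,0,0), (−1,−1,−1,−1,0,0,0,0,0), (0,0,0,0,0,1,0,0,0), (0,0,0,0,0,0,1,0,0), (0,0,0,0,0,0,0,1,0), (0,0,0,0,0,0,0,0,1), (−1,0,−1,−1,−1,0,0,0,0). Then M̃_σ has infinite multiplicative order: for every integer n ≥ 1, M̃_σⁿ ≠ I₉. -/
open Matrix in
/-- If `(A - 1) w = f` and `A f = f`, then `Aⁿ w = w + n f`. -/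
theorem pow_mulVec_eq_add_nsmul {m R : Type*} [Fintype m] [DecidableEq m] [Semiring R]
    {A : Matrix m m R} {w f : m → R} (hw : A *ᵥ w = w + f) (hf : A *ᵥ f = f) (n : ℕ) :
    A ^ n *ᵥ w = w + n • f := by
  have hfn : ∀ k : ℕ, A ^ k *ᵥ f = f := fun k => by
    induction k with
    | zero => simp
    | succ k ih => rw [pow_succ, ← mulVec_mulVec, hf, ih]
  induction n with
  | zero => simp
  | succ n ih => rw [pow_succ, ← mulVec_mulVec, hw, mulVec_add, ih, hfn, succ_nsmul, add_assoc]

/-- `M̃_σ` has infinite multiplicative order: `M̃_σⁿ ≠ I₉` for all `n ≥ 1`. -/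
theorem msigma_infinite_order : ∀ n : ℕ, 1 ≤ n → Msigma ^ n ≠ 1 := by
  intro n hn h
  have hw := pow_mulVec_eq_add_nsmul (A := Msigma) (w := ![-8, 1, 2, 3, 4, 3, 2, 1, 0])
    (f := ![4, -1, -1, -1, -1, -1, -1, -1, -1]) (by decide) (by decide) n
  rw [h, Matrix.one_mulVec] at hw
  have h0 := congrFun hw 0
  simp at h0
  omega
end
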